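/- (Deterministic form of Corollary 1.) Under Assumption 1 and the Algorithm hypotheses, let (π*, μ*) be a B-MFE. Then there exists a constant C > 0 depending only on |𝒮|, |𝒜|, d₁, d₂, d₃, c_π, c_μ, θ, and γ such that ‖(1/K) Σ_{k=1}^{K−1} π^k − π*‖_TV + ‖(1/K) Σ_{k=1}^{K−1} μ^k − μ*‖₁ ≤ C (K^{γ−1} + δ + ε_P + K^{θ−1} + ε_Q + K^{θ−γ} + ε). -/

import Mathlib

open Finset Real

noncomputable section MFG

/-- `μ` is a probability vector on the finite set `S`. -/
def isSimplex {S : Type*} [Fintype S] (μ : S → ℝ) : Prop :=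
  (∀ s, 0 ≤ μ s) ∧ ∑ s, μ s = 1

/-- `π : S → Δ(A)` is a policy. -/
def isPolicy {S A : Type*} [Fintype A] (po : S → A → ℝ) : Prop :=
  ∀ s, isSimplex (po s)

/-- The `ℓ¹` norm `‖f‖₁ = Σ_s |f s|`. -/
def l1Norm {S : Type*} [Fintype S] (f : S → ℝ) : ℝ := ∑ s, |f s|

/-- The TV-type norm `‖f‖_TV = max_s Σ_a |f s a|`. -/
def tvNorm {S A : Type*} [Fintype S] [Fintype A] [Nonempty S] (f : S → A → ℝ) : ℝ :=
  Finset.univ.sup' Finset.univ_nonempty (fun s => ∑ a, |f s a|)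

/-- The Frobenius norm of an `S × S` matrix. -/
def frobNorm {S : Type*} [Fintype S] (M : S → S → ℝ) : ℝ :=
  Real.sqrt (∑ s, ∑ s', (M s s') ^ 2)

/-- The softmax policy `softmax_λ(s,Q)_a = exp(λ Q(s,a))/Σ_{a'} exp(λ Q(s,a'))`. -/
def softmaxPol {S A : Type*} [Fintype A] (lam : ℝ) (Q : S → A → ℝ) (s : S) (a : A) : ℝ :=
  Real.exp (lam * Q s a) / ∑ a', Real.exp (lam * Q s a')

/-- The consistency operator `Γ₂(π,μ)(s') = Σ_{s,a} P(s'|s,a,μ) π(a|s) μ(s)`. -/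
def gamma2 {S A : Type*} [Fintype S] [Fintype A]
    (P : S → A → (S → ℝ) → S → ℝ) (po : S → A → ℝ) (μ : S → ℝ) (s' : S) : ℝ :=
  ∑ s, ∑ a, P s a μ s' * po s a * μ s

/-- The state-transition matrix `P_{π,μ}(s,s') = Σ_a P(s'|s,a,μ) π(a|s)`. -/
def transMat {S A : Type*} [Fintype A]
    (P : S → A → (S → ℝ) → S → ℝ) (po : S → A → ℝ) (μ : S → ℝ) (s s' : S) : ℝ :=
  ∑ a, P s a μ s' * po s a

end MFG

section Norms

variable {S A : Type*} [Fintype S] [Fintype A]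

lemma l1Norm_nonneg (f : S → ℝ) : 0 ≤ l1Norm f :=
  Finset.sum_nonneg fun _ _ => abs_nonneg _

lemma l1Norm_add_le (f g : S → ℝ) : l1Norm (fun s => f s + g s) ≤ l1Norm f + l1Norm g := by
  unfold l1Norm
  rw [← Finset.sum_add_distrib]
  exact Finset.sum_le_sum fun s _ => abs_add_le _ _

lemma l1Norm_sub_le (f g : S → ℝ) : l1Norm (fun s => f s - g s) ≤ l1Norm f + l1Norm g := by
  unfold l1Norm
  rw [← Finset.sum_add_distrib]
  exact Finset.sum_le_sum fun s _ => abs_sub _ _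

lemma l1Norm_sub_le_sub_add_sub (f g h : S → ℝ) :
    l1Norm (fun s => f s - h s) ≤ l1Norm (fun s => f s - g s) + l1Norm (fun s => g s - h s) := by
  simpa using l1Norm_add_le (fun s => f s - g s) (fun s => g s - h s)

lemma l1Norm_sub_comm (f g : S → ℝ) : l1Norm (fun s => f s - g s) = l1Norm (fun s => g s - f s) :=
  Finset.sum_congr rfl fun _ _ => abs_sub_comm _ _

lemma l1Norm_const_mul (c : ℝ) (f : S → ℝ) : l1Norm (fun s => c * f s) = |c| * l1Norm f := by
  simp only [l1Norm, abs_mul, Finset.mul_sum]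

lemma l1Norm_sum_le {ι : Type*} (t : Finset ι) (f : ι → S → ℝ) :
    l1Norm (fun s => ∑ i ∈ t, f i s) ≤ ∑ i ∈ t, l1Norm (f i) := by
  unfold l1Norm
  rw [Finset.sum_comm]
  exact Finset.sum_le_sum fun s _ => Finset.abs_sum_le_sum_abs _ _

lemma isSimplex.l1Norm_eq_one {μ : S → ℝ} (h : isSimplex μ) : l1Norm μ = 1 := by
  rw [← h.2]
  exact Finset.sum_congr rfl fun s _ => abs_of_nonneg (h.1 s)

lemma isSimplex.l1Norm_sub_le_two {μ ν : S → ℝ} (hμ : isSimplex μ) (hν : isSimplex ν) :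
    l1Norm (fun s => μ s - ν s) ≤ 2 := by
  have := l1Norm_sub_le μ ν
  rw [hμ.l1Norm_eq_one, hν.l1Norm_eq_one] at this
  linarith

lemma l1Norm_row_le_tvNorm [Nonempty S] (f : S → A → ℝ) (s : S) : l1Norm (f s) ≤ tvNorm f :=
  Finset.le_sup' (fun s => ∑ a, |f s a|) (Finset.mem_univ s)

lemma tvNorm_le [Nonempty S] {f : S → A → ℝ} {c : ℝ} (h : ∀ s, l1Norm (f s) ≤ c) :
    tvNorm f ≤ c :=
  Finset.sup'_le _ _ fun s _ => h s

lemma tvNorm_nonneg [Nonempty S] (f : S → A → ℝ) : 0 ≤ tvNorm f :=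
  (l1Norm_nonneg _).trans (l1Norm_row_le_tvNorm f (Classical.arbitrary S))

lemma tvNorm_sub_le_sub_add_sub [Nonempty S] (f g h : S → A → ℝ) :
    tvNorm (fun s a => f s a - h s a)
      ≤ tvNorm (fun s a => f s a - g s a) + tvNorm (fun s a => g s a - h s a) :=
  tvNorm_le fun s => (l1Norm_sub_le_sub_add_sub _ (g s) _).trans
    (add_le_add (l1Norm_row_le_tvNorm (fun s a => f s a - g s a) s)
      (l1Norm_row_le_tvNorm (fun s a => g s a - h s a) s))

lemma isPolicy.tvNorm_sub_le_two [Nonempty S] {po po' : S → A → ℝ}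
    (h : isPolicy po) (h' : isPolicy po') : tvNorm (fun s a => po s a - po' s a) ≤ 2 :=
  tvNorm_le fun s => (h s).l1Norm_sub_le_two (h' s)

lemma l1Norm_row_le_frobNorm (M : S → S → ℝ) (s : S) :
    l1Norm (M s) ≤ Fintype.card S * frobNorm M := by
  have h : ∀ s', |M s s'| ≤ frobNorm M := fun s' => by
    apply Real.abs_le_sqrt
    calc M s s' ^ 2 ≤ ∑ s', M s s' ^ 2 :=
          Finset.single_le_sum (f := fun s' => M s s' ^ 2) (fun _ _ => sq_nonneg _)
            (Finset.mem_univ s')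
      _ ≤ ∑ s, ∑ s', M s s' ^ 2 :=
          Finset.single_le_sum (f := fun s => ∑ s', M s s' ^ 2)
            (fun _ _ => Finset.sum_nonneg fun _ _ => sq_nonneg _) (Finset.mem_univ s)
  calc l1Norm (M s) ≤ ∑ _s' : S, frobNorm M := Finset.sum_le_sum fun s' _ => h s'
    _ = Fintype.card S * frobNorm M := by simp

lemma l1Norm_push_le {M : S → S → ℝ} {c : ℝ} (h : ∀ s, l1Norm (M s) ≤ c) (f : S → ℝ) :
    l1Norm (fun s => ∑ s', M s' s * f s') ≤ c * l1Norm f := by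
  refine (l1Norm_sum_le _ (fun s' s => M s' s * f s')).trans ?_
  conv_rhs => rw [l1Norm, Finset.mul_sum]
  refine Finset.sum_le_sum fun s' _ => ?_
  have : l1Norm (fun s => M s' s * f s') = |f s'| * l1Norm (M s') := by
    rw [← l1Norm_const_mul]
    simp only [mul_comm]
  rw [this, mul_comm]
  exact mul_le_mul_of_nonneg_right (h s') (abs_nonneg _)

lemma isSimplex.push {M : S → S → ℝ} (hM : ∀ s, isSimplex (M s)) {ν : S → ℝ} (hν : isSimplex ν) :
    isSimplex (fun s => ∑ s', M s' s * ν s') := by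
  refine ⟨fun s => Finset.sum_nonneg fun s' _ => mul_nonneg ((hM s').1 s) (hν.1 s'), ?_⟩
  rw [Finset.sum_comm]
  simp_rw [← Finset.sum_mul, (hM _).2, one_mul]
  exact hν.2

lemma isSimplex_uniform [Nonempty A] : isSimplex (fun _ : A => 1 / (Fintype.card A : ℝ)) :=
  ⟨fun _ => by positivity, by simp⟩

end Norms

section Softmax

variable {S A : Type*} [Fintype A] [Nonempty A]

lemma isPolicy_softmaxPol (lam : ℝ) (Q : S → A → ℝ) : isPolicy (softmaxPol lam Q) := by
  intro s
  have hpos : 0 < ∑ a', Real.exp (lam * Q s a') :=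
    Finset.sum_pos (fun _ _ => Real.exp_pos _) Finset.univ_nonempty
  refine ⟨fun a => div_nonneg (Real.exp_pos _).le hpos.le, ?_⟩
  simp only [softmaxPol]
  rw [← Finset.sum_div, div_self hpos.ne']

lemma softmaxPol_sub_le {lam η : ℝ} {Q Q' : S → A → ℝ} {s : S}
    (h : ∀ a, |lam * Q s a - lam * Q' s a| ≤ η) (a : A) :
    softmaxPol lam Q s a - softmaxPol lam Q' s a ≤ 2 * η * softmaxPol lam Q s a := by
  have hZ : 0 < ∑ a', Real.exp (lam * Q s a') :=
    Finset.sum_pos (fun _ _ => Real.exp_pos _) Finset.univ_nonempty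
  have hZ' : 0 < ∑ a', Real.exp (lam * Q' s a') :=
    Finset.sum_pos (fun _ _ => Real.exp_pos _) Finset.univ_nonempty
  have hZle : ∑ a', Real.exp (lam * Q' s a') ≤ Real.exp η * ∑ a', Real.exp (lam * Q s a') := by
    rw [Finset.mul_sum]
    refine Finset.sum_le_sum fun a' _ => ?_
    rw [← Real.exp_add]
    exact Real.exp_le_exp.mpr (by linarith [(abs_le.mp (h a')).1])
  have hnum : Real.exp (-η) * Real.exp (lam * Q s a) ≤ Real.exp (lam * Q' s a) := by
    rw [← Real.exp_add]
    exact Real.exp_le_exp.mpr (by linarith [(abs_le.mp (h a)).2])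
  have hexp : Real.exp (-(2 * η)) * softmaxPol lam Q s a ≤ softmaxPol lam Q' s a := by
    unfold softmaxPol
    calc Real.exp (-(2 * η)) * (Real.exp (lam * Q s a) / ∑ a', Real.exp (lam * Q s a'))
        = Real.exp (-η) * Real.exp (lam * Q s a)
            / (Real.exp η * ∑ a', Real.exp (lam * Q s a')) := by
          rw [show -(2 * η) = -η - η by ring, Real.exp_sub]
          field_simp
      _ ≤ Real.exp (lam * Q' s a) / ∑ a', Real.exp (lam * Q' s a') :=
          div_le_div₀ (Real.exp_pos _).le hnum hZ' hZle
  have hbound := mul_le_mul_of_nonneg_right (Real.add_one_le_exp (-(2 * η)))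
    ((isPolicy_softmaxPol lam Q s).1 a)
  linarith

lemma l1Norm_softmaxPol_sub_le {lam η : ℝ} {Q Q' : S → A → ℝ} {s : S}
    (h : ∀ a, |lam * Q s a - lam * Q' s a| ≤ η) :
    l1Norm (fun a => softmaxPol lam Q s a - softmaxPol lam Q' s a) ≤ 4 * η := by
  have hη : 0 ≤ η := (abs_nonneg _).trans (h (Classical.arbitrary A))
  have h' : ∀ a, |lam * Q' s a - lam * Q s a| ≤ η := fun a => by
    rw [abs_sub_comm]
    exact h a
  have hQ := isPolicy_softmaxPol lam Q s
  have hQ' := isPolicy_softmaxPol lam Q' s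
  calc l1Norm (fun a => softmaxPol lam Q s a - softmaxPol lam Q' s a)
      ≤ ∑ a, (2 * η * softmaxPol lam Q s a + 2 * η * softmaxPol lam Q' s a) := by
        refine Finset.sum_le_sum fun a _ => abs_le.mpr ⟨?_, ?_⟩
        · have := mul_nonneg (mul_nonneg zero_le_two hη) (hQ.1 a)
          linarith [softmaxPol_sub_le h' a]
        · have := mul_nonneg (mul_nonneg zero_le_two hη) (hQ'.1 a)
          linarith [softmaxPol_sub_le h a]
    _ = 4 * η := by
        rw [Finset.sum_add_distrib, ← Finset.mul_sum, ← Finset.mul_sum, hQ.2, hQ'.2]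
        ring

end Softmax

section Dynamics

variable {S A : Type*} [Fintype S] [Fintype A]

lemma gamma2_eq_push (P : S → A → (S → ℝ) → S → ℝ) (po : S → A → ℝ) (μ : S → ℝ) (s' : S) :
    gamma2 P po μ s' = ∑ s, transMat P po μ s s' * μ s := by
  simp only [gamma2, transMat, Finset.sum_mul]

lemma isSimplex_transMat {P : S → A → (S → ℝ) → S → ℝ} {po : S → A → ℝ} {μ : S → ℝ}
    (hP : ∀ s a, isSimplex (P s a μ)) (hpo : isPolicy po) (s : S) :
    isSimplex (transMat P po μ s) := by
  refine ⟨fun s' => Finset.sum_nonneg fun a _ => mul_nonneg ((hP s a).1 s') ((hpo s).1 a), ?_⟩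
  simp only [transMat]
  rw [Finset.sum_comm]
  simp_rw [← Finset.sum_mul, (hP s _).2, one_mul]
  exact (hpo s).2

/-- One step of the policy recursion, seen from a moving target `g`. -/
lemma l1Norm_policy_update_le {x x' D g g' q u : A → ℝ} {a ψ : ℝ} (ha : 0 ≤ a) (ha1 : a ≤ 1)
    (hψ : 0 ≤ ψ) (hq : isSimplex q) (hu : isSimplex u)
    (hx : ∀ i, x' i = (1 - a) * (x i + D i) + a * ((1 - ψ) * q i + ψ * u i)) :
    l1Norm (fun i => x' i - g' i)
      ≤ (1 - a) * l1Norm (fun i => x i - g i) + l1Norm D + l1Norm (fun i => g i - g' i)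
        + a * (l1Norm (fun i => q i - g' i) + 2 * ψ) := by
  have e : (fun i => x' i - g' i) = fun i => (1 - a) * ((x i - g i) + (D i + (g i - g' i)))
      + a * ((q i - g' i) + ψ * (u i - q i)) := by
    funext i
    rw [hx i]
    ring
  have h1 := l1Norm_add_le (fun i => (1 - a) * ((x i - g i) + (D i + (g i - g' i))))
    (fun i => a * ((q i - g' i) + ψ * (u i - q i)))
  rw [← e, l1Norm_const_mul, l1Norm_const_mul, abs_of_nonneg ha,
    abs_of_nonneg (sub_nonneg.mpr ha1)] at h1
  have h2 := l1Norm_add_le (fun i => x i - g i) (fun i => D i + (g i - g' i))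
  have h3 := l1Norm_add_le D (fun i => g i - g' i)
  have h4 := l1Norm_add_le (fun i => q i - g' i) (fun i => ψ * (u i - q i))
  rw [l1Norm_const_mul, abs_of_nonneg hψ] at h4
  have h5 := mul_le_mul_of_nonneg_left (hu.l1Norm_sub_le_two hq) hψ
  have h6 := mul_le_mul_of_nonneg_left (h2.trans (add_le_add_right h3 _)) (sub_nonneg.mpr ha1)
  have h7 := mul_le_mul_of_nonneg_left h4 ha
  have h8 := mul_le_mul_of_nonneg_left h5 ha
  have h9 := mul_nonneg ha (add_nonneg (l1Norm_nonneg D) (l1Norm_nonneg fun i => g i - g' i))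
  linarith

/-- The mean field moves by at most the drift, the projection error and twice the step size. -/
lemma l1Norm_mean_field_increment_le {μ μ' D : S → ℝ} {M : S → S → ℝ} {b η : ℝ} (hb : 0 ≤ b)
    (hM : ∀ s, isSimplex (M s)) (hν : isSimplex (fun s => μ s + D s))
    (hstep : l1Norm (fun s => μ' s - ((1 - b) * (μ s + D s)
      + b * ∑ s', M s' s * (μ s' + D s'))) ≤ η) :
    l1Norm (fun s => μ s - μ' s) ≤ η + l1Norm D + 2 * b := by
  have e : (fun s => μ' s - μ s) = fun s => (μ' s - ((1 - b) * (μ s + D s)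
      + b * ∑ s', M s' s * (μ s' + D s')))
      + (D s + b * (∑ s', M s' s * (μ s' + D s') - (μ s + D s))) := by
    funext s
    ring
  have h1 := l1Norm_add_le (fun s => μ' s - ((1 - b) * (μ s + D s)
      + b * ∑ s', M s' s * (μ s' + D s')))
    (fun s => D s + b * (∑ s', M s' s * (μ s' + D s') - (μ s + D s)))
  have h2 := l1Norm_add_le D (fun s => b * (∑ s', M s' s * (μ s' + D s') - (μ s + D s)))
  rw [l1Norm_const_mul, abs_of_nonneg hb] at h2
  have h3 := mul_le_mul_of_nonneg_left ((hν.push hM).l1Norm_sub_le_two hν) hb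
  rw [l1Norm_sub_comm, e]
  linarith

/-- One step of the mean-field recursion, compared with a fixed vector `ξ`. -/
lemma l1Norm_mean_field_update_le {μ μ' D ξ : S → ℝ} {M T : S → S → ℝ} {b η c : ℝ}
    (hb : 0 ≤ b) (hb1 : b ≤ 1) (hT : ∀ s, isSimplex (T s))
    (hMT : ∀ s, l1Norm (fun s' => M s s' - T s s') ≤ c) (hν : isSimplex (fun s => μ s + D s))
    (hstep : l1Norm (fun s => μ' s - ((1 - b) * (μ s + D s)
      + b * ∑ s', M s' s * (μ s' + D s'))) ≤ η) :
    l1Norm (fun s => μ' s - ξ s)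
      ≤ (1 - b) * l1Norm (fun s => μ s - ξ s)
        + b * l1Norm (fun s => ∑ s', T s' s * μ s' - ξ s) + b * c + l1Norm D + η := by
  have e : (fun s => μ' s - ξ s) = fun s => (μ' s - ((1 - b) * (μ s + D s)
      + b * ∑ s', M s' s * (μ s' + D s')))
      + ((1 - b) * ((μ s - ξ s) + D s) + b * ((∑ s', T s' s * μ s' - ξ s)
        + (∑ s', (M s' s - T s' s) * (μ s' + D s') + ∑ s', T s' s * D s'))) := by
    funext s
    simp only [sub_mul, mul_add, Finset.sum_sub_distrib, Finset.sum_add_distrib]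
    ring
  have h1 := l1Norm_add_le (fun s => μ' s - ((1 - b) * (μ s + D s)
      + b * ∑ s', M s' s * (μ s' + D s')))
    (fun s => (1 - b) * ((μ s - ξ s) + D s) + b * ((∑ s', T s' s * μ s' - ξ s)
        + (∑ s', (M s' s - T s' s) * (μ s' + D s') + ∑ s', T s' s * D s')))
  rw [← e] at h1
  have h2 := l1Norm_add_le (fun s => (1 - b) * ((μ s - ξ s) + D s))
    (fun s => b * ((∑ s', T s' s * μ s' - ξ s)
        + (∑ s', (M s' s - T s' s) * (μ s' + D s') + ∑ s', T s' s * D s')))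
  rw [l1Norm_const_mul, l1Norm_const_mul, abs_of_nonneg hb,
    abs_of_nonneg (sub_nonneg.mpr hb1)] at h2
  have h3 := mul_le_mul_of_nonneg_left (l1Norm_add_le (fun s => μ s - ξ s) D)
    (sub_nonneg.mpr hb1)
  have h4 := l1Norm_add_le (fun s => ∑ s', T s' s * μ s' - ξ s)
    (fun s => ∑ s', (M s' s - T s' s) * (μ s' + D s') + ∑ s', T s' s * D s')
  have h5 := l1Norm_add_le (fun s => ∑ s', (M s' s - T s' s) * (μ s' + D s'))
    (fun s => ∑ s', T s' s * D s')
  have h6 := l1Norm_push_le hMT (fun s => μ s + D s)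
  have h7 := l1Norm_push_le (fun s => (hT s).l1Norm_eq_one.le) D
  rw [hν.l1Norm_eq_one] at h6
  have h8 := mul_le_mul_of_nonneg_left
    (h4.trans (add_le_add_right (h5.trans (add_le_add h6 h7)) _)) hb
  linarith

end Dynamics

section Averaging

/-- Summation by parts for a contracting recursion with monotone inverse step sizes `w`. -/
lemma sum_le_of_recursion {u w B : ℕ → ℝ} {κ M : ℝ} (hw : ∀ k, w k ≤ w (k + 1)) (n : ℕ)
    (hu : ∀ k, 1 ≤ k → k ≤ n + 1 → u k ≤ M) (hw1 : 0 ≤ w 1)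
    (h : ∀ k, 1 ≤ k → k ≤ n → w (k + 1) * u (k + 1) ≤ (w (k + 1) - κ) * u k + B k) :
    κ * ∑ k ∈ Finset.Icc 1 n, u k + w (n + 1) * u (n + 1)
      ≤ M * w (n + 1) + ∑ k ∈ Finset.Icc 1 n, B k := by
  induction n with
  | zero => simpa [mul_comm] using mul_le_mul_of_nonneg_left (hu 1 le_rfl le_rfl) hw1
  | succ n ih =>
    have ih := ih (fun k h1 h2 => hu k h1 (by omega)) (fun k h1 h2 => h k h1 (by omega))
    rw [Finset.sum_Icc_succ_top (by omega), Finset.sum_Icc_succ_top (by omega)]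
    have h1 := h (n + 1) (by omega) le_rfl
    have h2 := mul_le_mul_of_nonneg_left (hu (n + 1) (by omega) (by omega))
      (sub_nonneg.mpr (hw (n + 1)))
    linarith

lemma sum_rpow_succ_le {x : ℝ} (hx : 0 < x) (hx1 : x < 1) (n : ℕ) :
    ∑ k ∈ Finset.Icc 1 n, ((k : ℝ) + 1) ^ (-x) ≤ ((n : ℝ) + 1) ^ (1 - x) / (1 - x) := by
  have hp : 0 < 1 - x := by linarith
  induction n with
  | zero => simp [hp.le]
  | succ n ih =>
    rw [Finset.sum_Icc_succ_top (by omega)]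
    push_cast
    set y : ℝ := (n : ℝ) + 1 + 1 with hy
    have hy0 : 0 < y := by positivity
    have hinv : y⁻¹ ≤ 1 := inv_le_one_of_one_le₀ (by rw [hy]; linarith [n.cast_nonneg (α := ℝ)])
    have hbern : (1 + -y⁻¹) ^ (1 - x) ≤ 1 + (1 - x) * -y⁻¹ :=
      rpow_one_add_le_one_add_mul_self (by linarith) hp.le (by linarith)
    have hsplit : ((n : ℝ) + 1) ^ (1 - x) = y ^ (1 - x) * (1 + -y⁻¹) ^ (1 - x) := by
      rw [← Real.mul_rpow hy0.le (by linarith)]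
      congr 1
      field_simp
      rw [hy]
      ring
    have hpow : y ^ (1 - x) * y⁻¹ = y ^ (-x) := by
      rw [← Real.rpow_neg_one y, ← Real.rpow_add hy0]
      congr 1
      ring
    have hmul := mul_le_mul_of_nonneg_left hbern (Real.rpow_nonneg hy0.le (1 - x))
    rw [← hsplit] at hmul
    rw [le_div_iff₀ hp] at ih ⊢
    rw [add_mul, ← hpow]
    linarith

lemma rpow_neg_le_two_mul_succ {p : ℝ} (hp : 0 ≤ p) (hp1 : p ≤ 1) {k : ℕ} (hk : 1 ≤ k) :
    (k : ℝ) ^ (-p) ≤ 2 * ((k : ℝ) + 1) ^ (-p) := by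
  have hk' : (1 : ℝ) ≤ k := by exact_mod_cast hk
  have h1 : ((k : ℝ) + 1) ^ p ≤ 2 * (k : ℝ) ^ p :=
    calc ((k : ℝ) + 1) ^ p ≤ (2 * k) ^ p :=
          Real.rpow_le_rpow (by positivity) (by linarith) hp
      _ = 2 ^ p * (k : ℝ) ^ p := Real.mul_rpow zero_le_two (by positivity)
      _ ≤ 2 ^ (1 : ℝ) * (k : ℝ) ^ p := by
          gcongr
          norm_num
      _ = 2 * (k : ℝ) ^ p := by rw [Real.rpow_one]
  have hkp : 0 < (k : ℝ) ^ p := by positivity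
  have hkp' : 0 < ((k : ℝ) + 1) ^ p := by positivity
  rw [Real.rpow_neg (by positivity), Real.rpow_neg (by positivity), ← div_eq_mul_inv,
    ← one_div, div_le_div_iff₀ hkp hkp']
  linarith

lemma sum_le_of_rpow_recursion {u B : ℕ → ℝ} {c p κ M : ℝ} (hc : 0 < c) (hp : 0 ≤ p) (n : ℕ)
    (hu0 : 0 ≤ u (n + 1)) (hu : ∀ k, 1 ≤ k → k ≤ n + 1 → u k ≤ M)
    (h : ∀ k, 1 ≤ k → k ≤ n → u (k + 1) ≤ (1 - κ * (c * ((k : ℝ) + 1) ^ (-p))) * u k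
      + c * ((k : ℝ) + 1) ^ (-p) * B k) :
    κ * ∑ k ∈ Finset.Icc 1 n, u k
      ≤ M * (((n : ℝ) + 1) ^ p / c) + ∑ k ∈ Finset.Icc 1 n, B k := by
  have key := sum_le_of_recursion (u := u) (w := fun k => (k : ℝ) ^ p / c) (B := B) (κ := κ)
    (M := M) (fun k => by gcongr; linarith [Nat.cast_succ (R := ℝ) k]) n hu (by positivity) ?_
  · push_cast at key
    have := mul_nonneg (div_nonneg (Real.rpow_nonneg (by positivity : (0 : ℝ) ≤ n + 1) p) hc.le) hu0
    linarith
  · intro k h1 h2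
    have hk : (0 : ℝ) < (k : ℝ) + 1 := by positivity
    have hone : ((k : ℝ) + 1) ^ p / c * (c * ((k : ℝ) + 1) ^ (-p)) = 1 := by
      rw [Real.rpow_neg hk.le]
      have := (Real.rpow_pos_of_pos hk p).ne'
      field_simp
    have hmul := mul_le_mul_of_nonneg_left (h k h1 h2)
      (by positivity : 0 ≤ ((k : ℝ) + 1) ^ p / c)
    push_cast
    refine hmul.trans (le_of_eq ?_)
    linear_combination (B k - κ * u k) * hone

lemma l1Norm_average_sub_le {S : Type*} [Fintype S] (f : ℕ → S → ℝ) {ξ : S → ℝ}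
    (hξ : isSimplex ξ) (n : ℕ) :
    l1Norm (fun s => 1 / ((n : ℝ) + 1) * ∑ k ∈ Finset.Icc 1 n, f k s - ξ s)
      ≤ 1 / ((n : ℝ) + 1) * (∑ k ∈ Finset.Icc 1 n, l1Norm (fun s => f k s - ξ s) + 1) := by
  have hn : (0 : ℝ) < (n : ℝ) + 1 := by positivity
  have e : (fun s => 1 / ((n : ℝ) + 1) * ∑ k ∈ Finset.Icc 1 n, f k s - ξ s)
      = fun s => 1 / ((n : ℝ) + 1) * (∑ k ∈ Finset.Icc 1 n, (f k s - ξ s) - ξ s) := by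
    funext s
    rw [Finset.sum_sub_distrib, Finset.sum_const, Nat.card_Icc, nsmul_eq_mul]
    push_cast
    field_simp
    ring
  rw [e, l1Norm_const_mul, abs_of_nonneg (by positivity)]
  refine mul_le_mul_of_nonneg_left ?_ (by positivity)
  refine (l1Norm_sub_le (fun s => ∑ k ∈ Finset.Icc 1 n, (f k s - ξ s)) ξ).trans ?_
  rw [hξ.l1Norm_eq_one]
  exact add_le_add_left (l1Norm_sum_le _ (fun k s => f k s - ξ s)) _

end Averaging

/-- deterministic form of Corollary 1: under the contraction assumption
and the Algorithm hypotheses, there is a constant `C > 0` depending only on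
`|𝒮|, |𝒜|, d₁, d₂, d₃, c_π, c_μ, θ, γ` such that
`‖(1/K) Σ_{k=1}^{K−1} π^k − π*‖_TV + ‖(1/K) Σ_{k=1}^{K−1} μ^k − μ*‖₁
  ≤ C (K^{γ−1} + δ + ε_P + K^{θ−1} + ε_Q + K^{θ−γ} + ε)`. -/
theorem sandbox_corollary_one {S A : Type*} [Fintype S] [Fintype A] [Nonempty S] [Nonempty A]
    (d1 d2 d3 : ℝ) (hd1 : 0 ≤ d1) (hd2 : 0 ≤ d2) (hd3 : 0 ≤ d3)
    (hd : d1 * d2 + d3 < 1)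
    (cpi cμ : ℝ) (hcpi : cpi ∈ Set.Ioc (0 : ℝ) 1) (hcμ : cμ ∈ Set.Ioc (0 : ℝ) 1)
    (θ γ : ℝ) (hθ : 0 < θ) (hθγ : θ < γ) (hγ : γ < 1) :
    ∃ C : ℝ, 0 < C ∧
      ∀ (P : S → A → (S → ℝ) → S → ℝ) (R : S → A → (S → ℝ) → ℝ)
        (ρ lam : ℝ) (Qstar : (S → ℝ) → S → A → ℝ)
        (K : ℕ) (ε δ εP εQ ψ εnet : ℝ)
        (μseq : ℕ → S → ℝ) (piSeq : ℕ → S → A → ℝ)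
        (Phat : ℕ → S → S → ℝ) (Qk : ℕ → S → A → ℝ)
        (Δμ : ℕ → S → ℝ) (Dpi : ℕ → S → A → ℝ)
        (piStar : S → A → ℝ) (μstar : S → ℝ),
        -- game data
        (∀ s a μ, isSimplex μ → isSimplex (P s a μ)) →
        (∀ s a μ, isSimplex μ → R s a μ ∈ Set.Icc (0 : ℝ) 1) →
        ρ ∈ Set.Ioo (0 : ℝ) 1 → 0 < lam →
        -- Q*_μ is the fixed point of the Bellman operator of the MDP induced by μ
        (∀ μ, isSimplex μ → ∀ s a,
          Qstar μ s a = R s a μ + ρ * ∑ s',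
            P s a μ s' * Finset.univ.sup' Finset.univ_nonempty (fun a' => Qstar μ s' a')) →
        -- Assumption 1 (contraction)
        (∀ μ μ', isSimplex μ → isSimplex μ' →
          tvNorm (fun s a => softmaxPol lam (Qstar μ) s a - softmaxPol lam (Qstar μ') s a)
            ≤ d1 * l1Norm (fun s => μ s - μ' s)) →
        (∀ po po' μ, isPolicy po → isPolicy po' → isSimplex μ →
          l1Norm (fun s' => gamma2 P po μ s' - gamma2 P po' μ s')
            ≤ d2 * tvNorm (fun s a => po s a - po' s a)) →
        (∀ po μ μ', isPolicy po → isSimplex μ → isSimplex μ' →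
          l1Norm (fun s' => gamma2 P po μ s' - gamma2 P po μ' s')
            ≤ d3 * l1Norm (fun s => μ s - μ' s)) →
        -- (π*, μ*) is a B-MFE
        isPolicy piStar → isSimplex μstar →
        (∀ s a, piStar s a = softmaxPol lam (Qstar μstar) s a) →
        (∀ s', μstar s' = gamma2 P piStar μstar s') →
        -- algorithm scalars
        2 ≤ K → 0 < ε → 0 ≤ δ → 0 ≤ εP → 0 ≤ εQ →
        ψ ∈ Set.Icc (0 : ℝ) (ε / 4) →
        0 ≤ εnet → εnet ≤ cμ * (1 - (d1 * d2 + d3)) * ε * (K : ℝ) ^ (-γ) →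
        -- iterates are well-formed
        (∀ k, 1 ≤ k → k ≤ K → isSimplex (μseq k)) →
        (∀ k, 1 ≤ k → k ≤ K → isPolicy (piSeq k)) →
        (∀ k, 1 ≤ k → k ≤ K → ∀ s, isSimplex (Phat k s)) →
        (∀ k, 1 ≤ k → k ≤ K - 1 → isSimplex (fun s => μseq k s + Δμ k s)) →
        (∀ k, 1 ≤ k → k ≤ K - 1 → isPolicy (fun s a => piSeq k s a + Dpi k s a)) →
        -- (i) policy update
        (∀ k, 1 ≤ k → k ≤ K - 1 → ∀ s a,
          piSeq (k + 1) s a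
            = (1 - cpi * ((k : ℝ) + 1) ^ (-θ)) * (piSeq k s a + Dpi k s a)
              + cpi * ((k : ℝ) + 1) ^ (-θ)
                * ((1 - ψ) * softmaxPol lam (Qk (k + 1)) s a
                   + ψ * (1 / (Fintype.card A : ℝ)))) →
        -- (ii) mean-field update up to projection error ε_net
        (∀ k, 1 ≤ k → k ≤ K - 1 →
          l1Norm (fun s => μseq (k + 1) s
            - ((1 - cμ * ((k : ℝ) + 1) ^ (-γ)) * (μseq k s + Δμ k s)
               + cμ * ((k : ℝ) + 1) ^ (-γ)
                 * ∑ s', Phat k s' s * (μseq k s' + Δμ k s'))) ≤ εnet) →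
        -- (iii) drift bounds
        (∀ k, 1 ≤ k → k ≤ K - 1 → tvNorm (Dpi k) ≤ cpi * (k : ℝ) ^ (-θ) * δ) →
        (∀ k, 1 ≤ k → k ≤ K - 1 → l1Norm (Δμ k) ≤ cμ * (k : ℝ) ^ (-γ) * δ) →
        -- (iv) transition-matrix estimation error
        (∀ k, 1 ≤ k → k ≤ K →
          frobNorm (fun s s' => Phat k s s' - transMat P (piSeq k) (μseq k) s s') ≤ εP) →
        -- (v) Q-function estimation error
        (∀ k, 1 ≤ k → k ≤ K → ∀ s a, |Qk k s a - Qstar (μseq k) s a| ≤ εQ / lam) →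
        -- conclusion
        tvNorm (fun s a =>
            (1 / (K : ℝ)) * (∑ k ∈ Finset.Icc 1 (K - 1), piSeq k s a) - piStar s a)
          + l1Norm (fun s =>
              (1 / (K : ℝ)) * (∑ k ∈ Finset.Icc 1 (K - 1), μseq k s) - μstar s)
          ≤ C * ((K : ℝ) ^ (γ - 1) + δ + εP + (K : ℝ) ^ (θ - 1) + εQ
                  + (K : ℝ) ^ (θ - γ) + ε) := by
  obtain ⟨hcpi0, hcpi1⟩ := hcpi
  obtain ⟨hcμ0, hcμ1⟩ := hcμ
  have hd0 : 0 ≤ d1 * d2 + d3 := by positivity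
  have hd' : 0 < 1 - (d1 * d2 + d3) := by linarith
  have hx : 0 < γ - θ := by linarith
  have hx1 : 0 < 1 - (γ - θ) := by linarith
  obtain ⟨Ce, hCe⟩ : ∃ Ce, Ce = 2 / cpi + (4 + 2 * (d1 / cpi))
    + 2 * (d1 / cpi) / (1 - (γ - θ)) := ⟨_, rfl⟩
  obtain ⟨Cm, hCm⟩ : ∃ Cm, Cm = (2 / cμ + 2 + (Fintype.card S : ℝ) + d2 * Ce)
    / (1 - (d1 * d2 + d3)) := ⟨_, rfl⟩
  have hg0 : 0 ≤ d1 / cpi := by positivity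
  have hCe0 : 0 ≤ Ce := by rw [hCe]; positivity
  have hCm0 : 0 ≤ Cm := by rw [hCm]; positivity
  refine ⟨Ce + (d1 + 1) * Cm + 2, by positivity, ?_⟩
  intro P R ρ lam Qstar K ε δ εP εQ ψ εnet μseq piSeq Phat Qk Δμ Dpi piStar μstar
    hP _ _ hlam _ hΓ₁ hΓ₂pi hΓ₂μ hpiStar hμstar hpiFix hμFix hK hε hδ hεP hεQ hψ _ hεnet
    hμ hpi hPhat hμD _ hpiUpd hμUpd hDpi hDμ hfrob hQ
  obtain ⟨n, rfl⟩ : ∃ n, K = n + 1 := ⟨K - 1, by omega⟩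
  simp only [Nat.add_sub_cancel] at *
  push_cast at *
  obtain ⟨G, hG⟩ : ∃ G : ℕ → S → A → ℝ, G = fun k => softmaxPol lam (Qstar (μseq k)) := ⟨_, rfl⟩
  have hGpol : ∀ k, isPolicy (G k) := fun k => hG ▸ isPolicy_softmaxPol lam (Qstar (μseq k))
  obtain ⟨e, he⟩ : ∃ e : ℕ → ℝ, e = fun k => tvNorm (fun s a => piSeq k s a - G k s a) :=
    ⟨_, rfl⟩
  obtain ⟨m, hm⟩ : ∃ m : ℕ → ℝ, m = fun k => l1Norm (fun s => μseq k s - μstar s) := ⟨_, rfl⟩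
  have hstep1 : ∀ {p : ℝ} (k : ℕ), 0 < p → ((k : ℝ) + 1) ^ (-p) ≤ 1 := fun k hp =>
    Real.rpow_le_one_of_one_le_of_nonpos (by linarith [k.cast_nonneg (α := ℝ)]) (by linarith)
  have hdrift : ∀ {c p : ℝ} {k : ℕ}, 0 < c → 0 < p → p < 1 → 1 ≤ k →
      c * (k : ℝ) ^ (-p) * δ ≤ 2 * (c * ((k : ℝ) + 1) ^ (-p)) * δ := fun {c p k} hc hp hp1 hk => by
    have := mul_le_mul_of_nonneg_left (rpow_neg_le_two_mul_succ hp.le hp1.le hk) hc.le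
    exact mul_le_mul_of_nonneg_right (by linarith) hδ
  have hnet : ∀ k : ℕ, k ≤ n →
      εnet ≤ cμ * ((k : ℝ) + 1) ^ (-γ) * ((1 - (d1 * d2 + d3)) * ε) := fun k hk => by
    have hkn : (k : ℝ) ≤ n := by exact_mod_cast hk
    have h1 : ((n : ℝ) + 1) ^ (-γ) ≤ ((k : ℝ) + 1) ^ (-γ) :=
      Real.rpow_le_rpow_of_nonpos (by positivity) (by linarith) (by linarith)
    have h2 := mul_le_mul_of_nonneg_left h1 (by positivity : 0 ≤ cμ * (1 - (d1 * d2 + d3)) * ε)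
    linarith
  have hpiDist : ∀ k, 1 ≤ k → k ≤ n + 1 →
      tvNorm (fun s a => piSeq k s a - piStar s a) ≤ e k + d1 * m k := fun k h1 h2 => by
    have h := tvNorm_sub_le_sub_add_sub (piSeq k) (G k) piStar
    have h' := hΓ₁ (μseq k) μstar (hμ k h1 h2) hμstar
    simp only [← hpiFix] at h'
    simp only [he, hm]
    rw [hG] at h ⊢
    linarith
  have he_rec : ∀ k, 1 ≤ k → k ≤ n →
      e (k + 1) ≤ (1 - 1 * (cpi * ((k : ℝ) + 1) ^ (-θ))) * e k + cpi * ((k : ℝ) + 1) ^ (-θ)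
        * ((2 + 2 * (d1 / cpi)) * δ + (d1 / cpi + 1 / 2) * ε + 4 * εQ
          + 2 * (d1 / cpi) * ((k : ℝ) + 1) ^ (-(γ - θ))) := by
    intro k h1 h2
    have hk : (0 : ℝ) < (k : ℝ) + 1 := by positivity
    obtain ⟨z, hz⟩ : ∃ z, z = ((k : ℝ) + 1) ^ (-(γ - θ)) := ⟨_, rfl⟩
    obtain ⟨a, ha⟩ : ∃ a, a = cpi * ((k : ℝ) + 1) ^ (-θ) := ⟨_, rfl⟩
    obtain ⟨b, hb⟩ : ∃ b, b = cμ * ((k : ℝ) + 1) ^ (-γ) := ⟨_, rfl⟩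
    have hz0 : 0 ≤ z := by rw [hz]; positivity
    have hz1 : z ≤ 1 := hz ▸ hstep1 k hx
    have ha0 : 0 ≤ a := by rw [ha]; positivity
    have ha1 : a ≤ 1 := by
      rw [ha]
      exact mul_le_one₀ hcpi1 (by positivity) (hstep1 k hθ)
    have hb0 : 0 ≤ b := by rw [hb]; positivity
    have hbz : b ≤ a / cpi * z := by
      have hzz : a / cpi * z = ((k : ℝ) + 1) ^ (-γ) := by
        rw [ha, hz, mul_div_cancel_left₀ _ hcpi0.ne', ← Real.rpow_add hk]
        congr 1
        ring
      rw [hzz, hb]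
      exact mul_le_of_le_one_left (by positivity) hcμ1
    have hinc := l1Norm_mean_field_increment_le (μ := μseq k) (μ' := μseq (k + 1)) (D := Δμ k)
      hb0 (hPhat k h1 (by omega)) (hμD k h1 h2) (hb ▸ hμUpd k h1 h2)
    have hDμk := (hDμ k h1 h2).trans (hdrift hcμ0 (by linarith) hγ h1)
    have hDpik := (hDpi k h1 h2).trans (hdrift hcpi0 hθ (by linarith) h1)
    have hnetk := hnet k h2
    rw [← hb] at hDμk hnetk
    rw [← ha] at hDpik
    have hGG : tvNorm (fun s i => G k s i - G (k + 1) s i)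
        ≤ a * (d1 / cpi * (ε + 2 * δ) + 2 * (d1 / cpi) * z) := by
      have h3 := hΓ₁ (μseq k) (μseq (k + 1)) (hμ k h1 (by omega)) (hμ _ (by omega) (by omega))
      have hεd : (1 - (d1 * d2 + d3)) * ε ≤ ε := mul_le_of_le_one_left hε.le (by linarith)
      have h4 := mul_le_mul_of_nonneg_left hεd hb0
      have h5 : a / cpi * z ≤ a / cpi := mul_le_of_le_one_right (by positivity) hz1
      have h6 : b * (ε + 2 * δ) ≤ a / cpi * (ε + 2 * δ) :=
        mul_le_mul_of_nonneg_right (hbz.trans h5) (by positivity)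
      have h7 : l1Norm (fun s => μseq k s - μseq (k + 1) s)
          ≤ a / cpi * (ε + 2 * δ) + 2 * (a / cpi * z) := by linarith
      have h8 := mul_le_mul_of_nonneg_left h7 hd1
      rw [hG]
      refine h3.trans (h8.trans (le_of_eq ?_))
      ring
    rw [← ha, ← hz]
    have hrow : ∀ s, l1Norm (fun i => piSeq (k + 1) s i - G (k + 1) s i)
        ≤ (1 - a) * e k + 2 * a * δ + a * (d1 / cpi * (ε + 2 * δ) + 2 * (d1 / cpi) * z)
          + a * (4 * εQ + 2 * ψ) := fun s => by
      have h3 := l1Norm_policy_update_le (x := piSeq k s) (x' := piSeq (k + 1) s) (D := Dpi k s)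
        (g := G k s) (g' := G (k + 1) s) ha0 ha1 hψ.1 (isPolicy_softmaxPol lam (Qk (k + 1)) s)
        isSimplex_uniform (ha ▸ hpiUpd k h1 h2 s)
      have h4 : l1Norm (fun i => softmaxPol lam (Qk (k + 1)) s i - G (k + 1) s i) ≤ 4 * εQ := by
        rw [hG]
        refine l1Norm_softmaxPol_sub_le fun i => ?_
        rw [← mul_sub, abs_mul, abs_of_pos hlam, mul_comm]
        exact (le_div_iff₀ hlam).mp (hQ (k + 1) (by omega) (by omega) s i)
      have h5 := l1Norm_row_le_tvNorm (fun s i => piSeq k s i - G k s i) s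
      have h6 := l1Norm_row_le_tvNorm (fun s i => G k s i - G (k + 1) s i) s
      have h7 := l1Norm_row_le_tvNorm (Dpi k) s
      have h8 := mul_le_mul_of_nonneg_left h5 (sub_nonneg.mpr ha1)
      have h9 := mul_le_mul_of_nonneg_left h4 ha0
      simp only [he]
      linarith
    have htv := tvNorm_le hrow
    have hψa := mul_le_mul_of_nonneg_left hψ.2 ha0
    simp only [he] at htv ⊢
    linarith
  have hm_rec : ∀ k, 1 ≤ k → k ≤ n →
      m (k + 1) ≤ (1 - (1 - (d1 * d2 + d3)) * (cμ * ((k : ℝ) + 1) ^ (-γ))) * m k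
        + cμ * ((k : ℝ) + 1) ^ (-γ) * ((2 * δ + Fintype.card S * εP + ε) + d2 * e k) := by
    intro k h1 h2
    obtain ⟨b, hb⟩ : ∃ b, b = cμ * ((k : ℝ) + 1) ^ (-γ) := ⟨_, rfl⟩
    have hb0 : 0 ≤ b := by rw [hb]; positivity
    have hb1 : b ≤ 1 := by
      rw [hb]
      exact mul_le_one₀ hcμ1 (by positivity) (hstep1 k (by linarith))
    have hμk := hμ k h1 (by omega)
    have hpik := hpi k h1 (by omega)
    have hest : ∀ s, l1Norm (fun s' => Phat k s s' - transMat P (piSeq k) (μseq k) s s')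
        ≤ Fintype.card S * εP := fun s =>
      (l1Norm_row_le_frobNorm (fun s s' => Phat k s s' - transMat P (piSeq k) (μseq k) s s')
        s).trans (mul_le_mul_of_nonneg_left (hfrob k h1 (by omega)) (Nat.cast_nonneg _))
    have h3 := l1Norm_mean_field_update_le (ξ := μstar) hb0 hb1
      (isSimplex_transMat (fun s a => hP s a _ hμk) hpik) hest (hμD k h1 h2)
      (hb ▸ hμUpd k h1 h2)
    have hΓ : l1Norm (fun s => ∑ s', transMat P (piSeq k) (μseq k) s' s * μseq k s' - μstar s)
        ≤ (d1 * d2 + d3) * m k + d2 * e k := by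
      have h4 := l1Norm_sub_le_sub_add_sub (gamma2 P (piSeq k) (μseq k))
        (gamma2 P (piSeq k) μstar) (gamma2 P piStar μstar)
      have h5 := hΓ₂μ (piSeq k) (μseq k) μstar hpik hμk hμstar
      have h6 := hΓ₂pi (piSeq k) piStar μstar hpik hpiStar hμstar
      have h7 := mul_le_mul_of_nonneg_left (hpiDist k h1 (by omega)) hd2
      simp only [← hμFix] at h4 h6
      simp only [← gamma2_eq_push]
      simp only [hm] at h7 ⊢
      linarith
    have hDμk := (hDμ k h1 h2).trans (hdrift hcμ0 (by linarith) hγ h1)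
    have hnetk := hnet k h2
    rw [← hb] at hDμk hnetk ⊢
    have hεd : (1 - (d1 * d2 + d3)) * ε ≤ ε := mul_le_of_le_one_left hε.le (by linarith)
    have h8 := mul_le_mul_of_nonneg_left hεd hb0
    have h9 := mul_le_mul_of_nonneg_left hΓ hb0
    simp only [hm] at h9 ⊢
    linarith
  have hN : (0 : ℝ) < (n : ℝ) + 1 := by positivity
  have hN1 : (1 : ℝ) ≤ (n : ℝ) + 1 := by linarith [n.cast_nonneg (α := ℝ)]
  have hshift : ∀ p : ℝ, 1 / ((n : ℝ) + 1) * ((n : ℝ) + 1) ^ p = ((n : ℝ) + 1) ^ (p - 1) :=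
    fun p => by rw [Real.rpow_sub_one hN.ne']; ring
  have hfrac : 1 / ((n : ℝ) + 1) * n ≤ 1 := by
    rw [one_div_mul_eq_div, div_le_one hN]
    linarith
  have hinv : 1 / ((n : ℝ) + 1) ≤ ((n : ℝ) + 1) ^ (γ - 1) := by
    have := Real.one_le_rpow hN1 (by linarith : 0 ≤ γ)
    rw [← hshift]
    exact le_mul_of_one_le_right (by positivity) this
  have hinv0 : 0 ≤ 1 / ((n : ℝ) + 1) := by positivity
  obtain ⟨T, hT⟩ : ∃ T, T = ((n : ℝ) + 1) ^ (γ - 1) + δ + εP + ((n : ℝ) + 1) ^ (θ - 1) + εQ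
    + ((n : ℝ) + 1) ^ (θ - γ) + ε := ⟨_, rfl⟩
  have hX1 : 0 ≤ ((n : ℝ) + 1) ^ (γ - 1) := by positivity
  have hX2 : 0 ≤ ((n : ℝ) + 1) ^ (θ - 1) := by positivity
  have hX3 : 0 ≤ ((n : ℝ) + 1) ^ (θ - γ) := by positivity
  have he_avg : 1 / ((n : ℝ) + 1) * ∑ k ∈ Finset.Icc 1 n, e k ≤ Ce * T := by
    obtain ⟨E, hE⟩ : ∃ E, E = (2 + 2 * (d1 / cpi)) * δ + (d1 / cpi + 1 / 2) * ε + 4 * εQ :=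
      ⟨_, rfl⟩
    have hE0 : 0 ≤ E := by rw [hE]; positivity
    have h1 := sum_le_of_rpow_recursion (M := 2) hcpi0 hθ.le n (by rw [he]; exact tvNorm_nonneg _)
      (fun k h1 h2 => by rw [he]; exact (hpi k h1 h2).tvNorm_sub_le_two (hGpol k)) he_rec
    rw [← hE, Finset.sum_add_distrib, Finset.sum_const, Nat.card_Icc, nsmul_eq_mul,
      ← Finset.mul_sum, one_mul, Nat.add_sub_cancel] at h1
    have h2 := mul_le_mul_of_nonneg_left (sum_rpow_succ_le hx (by linarith) n)
      (by positivity : 0 ≤ 2 * (d1 / cpi))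
    have h3 := mul_le_mul_of_nonneg_left (h1.trans (add_le_add_right (add_le_add_right h2 _) _))
      hinv0
    have h4 := hshift θ
    have h5 := hshift (1 - (γ - θ))
    rw [show 1 - (γ - θ) - 1 = θ - γ by ring] at h5
    have h6 : 1 / ((n : ℝ) + 1) * (2 * (((n : ℝ) + 1) ^ θ / cpi) + (n * E
        + 2 * (d1 / cpi) * (((n : ℝ) + 1) ^ (1 - (γ - θ)) / (1 - (γ - θ)))))
        = 2 / cpi * ((n : ℝ) + 1) ^ (θ - 1) + 1 / ((n : ℝ) + 1) * n * E
          + 2 * (d1 / cpi) / (1 - (γ - θ)) * ((n : ℝ) + 1) ^ (θ - γ) := by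
      rw [← h4, ← h5]
      ring
    have h7 := mul_le_mul_of_nonneg_right hfrac hE0
    have h8 : 2 / cpi * ((n : ℝ) + 1) ^ (θ - 1) ≤ 2 / cpi * T :=
      mul_le_mul_of_nonneg_left (by linarith) (by positivity)
    have h9 : 2 * (d1 / cpi) / (1 - (γ - θ)) * ((n : ℝ) + 1) ^ (θ - γ)
        ≤ 2 * (d1 / cpi) / (1 - (γ - θ)) * T :=
      mul_le_mul_of_nonneg_left (by linarith) (by positivity)
    have h10 : (4 + 2 * (d1 / cpi)) * (δ + ε + εQ) ≤ (4 + 2 * (d1 / cpi)) * T :=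
      mul_le_mul_of_nonneg_left (by linarith) (by positivity)
    have h11 := mul_nonneg hg0 hε.le
    have h12 := mul_nonneg hg0 hεQ
    rw [hCe, add_mul, add_mul]
    linarith
  have hm_avg : 1 / ((n : ℝ) + 1) * ∑ k ∈ Finset.Icc 1 n, m k ≤ Cm * T := by
    obtain ⟨E, hE⟩ : ∃ E, E = 2 * δ + Fintype.card S * εP + ε := ⟨_, rfl⟩
    have hE0 : 0 ≤ E := by rw [hE]; positivity
    have h1 := sum_le_of_rpow_recursion (M := 2) hcμ0 (hθ.trans hθγ).le n
      (by rw [hm]; exact l1Norm_nonneg _)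
      (fun k h1 h2 => by rw [hm]; exact (hμ k h1 h2).l1Norm_sub_le_two hμstar) hm_rec
    rw [← hE, Finset.sum_add_distrib, Finset.sum_const, Nat.card_Icc, nsmul_eq_mul,
      ← Finset.mul_sum, Nat.add_sub_cancel] at h1
    have h2 := mul_le_mul_of_nonneg_left h1 hinv0
    have h3 : 1 / ((n : ℝ) + 1) * (2 * (((n : ℝ) + 1) ^ γ / cμ)
        + (n * E + d2 * ∑ k ∈ Finset.Icc 1 n, e k))
        = 2 / cμ * ((n : ℝ) + 1) ^ (γ - 1) + 1 / ((n : ℝ) + 1) * n * E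
          + d2 * (1 / ((n : ℝ) + 1) * ∑ k ∈ Finset.Icc 1 n, e k) := by
      rw [← hshift γ]
      ring
    have h4 := mul_le_mul_of_nonneg_right hfrac hE0
    have h5 := mul_le_mul_of_nonneg_left he_avg hd2
    have h6 : 2 / cμ * ((n : ℝ) + 1) ^ (γ - 1) ≤ 2 / cμ * T :=
      mul_le_mul_of_nonneg_left (by linarith) (by positivity)
    have h7 : (Fintype.card S : ℝ) * εP ≤ Fintype.card S * T :=
      mul_le_mul_of_nonneg_left (by linarith) (by positivity)
    rw [hCm, div_mul_eq_mul_div _ _ T, le_div_iff₀ hd']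
    linarith
  have htv : tvNorm (fun s a =>
      1 / ((n : ℝ) + 1) * ∑ k ∈ Finset.Icc 1 n, piSeq k s a - piStar s a)
      ≤ 1 / ((n : ℝ) + 1) * (∑ k ∈ Finset.Icc 1 n, e k
        + d1 * ∑ k ∈ Finset.Icc 1 n, m k + 1) := by
    refine tvNorm_le fun s => (l1Norm_average_sub_le (fun k => piSeq k s) (hpiStar s) n).trans
      (mul_le_mul_of_nonneg_left (add_le_add_left ?_ _) hinv0)
    rw [Finset.mul_sum, ← Finset.sum_add_distrib]
    refine Finset.sum_le_sum fun k hk => ?_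
    rw [Finset.mem_Icc] at hk
    exact (l1Norm_row_le_tvNorm (fun s a => piSeq k s a - piStar s a) s).trans
      (hpiDist k hk.1 (by omega))
  have hl1 : l1Norm (fun s =>
      1 / ((n : ℝ) + 1) * ∑ k ∈ Finset.Icc 1 n, μseq k s - μstar s)
      ≤ 1 / ((n : ℝ) + 1) * (∑ k ∈ Finset.Icc 1 n, m k + 1) := by
    rw [hm]
    exact l1Norm_average_sub_le μseq hμstar n
  have hdm := mul_le_mul_of_nonneg_left hm_avg hd1
  have hinvT : 1 / ((n : ℝ) + 1) ≤ T := by linarith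
  rw [← hT]
  linarith
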